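/- arXiv:1611.01214 — 10 statements merged into one kernel-verified Lean document; each statement's English description precedes it below -/
import Mathlib

section
/- In every diassociative algebra D over a commutative ring R, the Jordan diproduct a • b := a ⊣ b + b ⊢ a satisfies the three (right) Jordan dialgebra identities: right commutativity a • (b • c) = a • (c • b); the right quasi-Jordan identity (b • a) • (a • a) = (b • (a • a)) • a; and the right associator-derivation identity (b, a • a, c) = 2·((b, a, c) • a), where (x,y,z) := (x • y) • z − x • (y • z) is the associator, for all a, b, c ∈ D. -/
theorem diassociative_jordan_diproduct (R : Type*) [CommRing R] (D : Type*) [AddCommGroup D] [Module R D]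
    (l r : D →ₗ[R] D →ₗ[R] D)
    (hl : ∀ a b c : D, l (l a b) c = l a (l b c))
    (hr : ∀ a b c : D, r (r a b) c = r a (r b c))
    (hin : ∀ a b c : D, l (r a b) c = r a (l b c))
    (hlb : ∀ a b c : D, r (l a b) c = r (r a b) c)
    (hrb : ∀ a b c : D, l a (l b c) = l a (r b c))
    (bl : D → D → D) (hbl : ∀ a b : D, bl a b = l a b + r b a)
    (assoc : D → D → D → D)
    (hassoc : ∀ x y z : D, assoc x y z = bl (bl x y) z - bl x (bl y z)) :
    (∀ a b c : D, bl a (bl b c) = bl a (bl c b)) ∧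
    (∀ a b : D, bl (bl b a) (bl a a) = bl (bl b (bl a a)) a) ∧
    (∀ a b c : D, assoc b (bl a a) c = 2 • bl (assoc b a c) a) := by
  refine ⟨fun a b c => ?_, fun a b => ?_, fun a b c => ?_⟩ <;>
  · simp only [hassoc, hbl, two_nsmul, map_add, map_sub, LinearMap.add_apply,
      LinearMap.sub_apply, hl, hr, hin, hlb, ← hrb]
    abel
end

section
/- In every triassociative algebra T over a commutative ring R, the operations [a,b] := a ⊥ b − b ⊥ a and {a,b} := a ⊣ b − b ⊢ a satisfy the defining identities of (right) Lie trialgebras, for all a, b, c ∈ T: (i) [a,a] = 0 and the Jacobi identity [[a,b],c] + [[b,c],a] + [[c,a],b] = 0; (ii) the right Leibniz identity {{a,b},c} = {{a,c},b} + {a,{b,c}}; (iii) {a,[b,c]} = {a,{b,c}}; (iv) {[a,b],c} = [{a,c},b] + [a,{b,c}]. -/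
theorem triassociative_lie_trialgebra (R : Type*) [CommRing R] (T : Type*) [AddCommGroup T] [Module R T]
    (l p r : T →ₗ[R] T →ₗ[R] T)
    (hla : ∀ a b c : T, l (l a b) c = l a (l b c))
    (hpa : ∀ a b c : T, p (p a b) c = p a (p b c))
    (hra : ∀ a b c : T, r (r a b) c = r a (r b c))
    (hbar1 : ∀ a b c : T, l a (l b c) = l a (p b c))
    (hbar2 : ∀ a b c : T, l a (l b c) = l a (r b c))
    (hbar3 : ∀ a b c : T, r (r a b) c = r (p a b) c)
    (hbar4 : ∀ a b c : T, r (r a b) c = r (l a b) c)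
    (hin1 : ∀ a b c : T, l (r a b) c = r a (l b c))
    (hin2 : ∀ a b c : T, p (r a b) c = r a (p b c))
    (hin3 : ∀ a b c : T, l (p a b) c = p a (l b c))
    (hLR : ∀ a b c : T, p (l a b) c = p a (r b c))
    (br : T → T → T) (hbr : ∀ a b : T, br a b = p a b - p b a)
    (cu : T → T → T) (hcu : ∀ a b : T, cu a b = l a b - r b a) :
    (∀ a : T, br a a = 0) ∧
    (∀ a b c : T, br (br a b) c + br (br b c) a + br (br c a) b = 0) ∧
    (∀ a b c : T, cu (cu a b) c = cu (cu a c) b + cu a (cu b c)) ∧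
    (∀ a b c : T, cu a (br b c) = cu a (cu b c)) ∧
    (∀ a b c : T, cu (br a b) c = br (cu a c) b + br a (cu b c)) := by
  refine ⟨fun a => ?_, fun a b c => ?_, fun a b c => ?_, fun a b c => ?_, fun a b c => ?_⟩ <;>
    simp only [hbr, hcu, map_sub, LinearMap.sub_apply, hla, hpa, hra, ← hbar1, ← hbar2, ← hbar3,
      ← hbar4, hin1, hin2, hin3, hLR] <;>
    abel
end

section
/- In every tridendriform algebra T over a commutative ring R, the operations [a,b] := a ∧ b − b ∧ a and {a,b} := a ≺ b − b ≻ a satisfy the defining identities of (right) post-Lie algebras, for all a, b, c ∈ T: (i) [a,a] = 0 and the Jacobi identity [[a,b],c] + [[b,c],a] + [[c,a],b] = 0; (ii) {-,-} is a right derivation of [-,-]: {[a,b],c} = [{a,c},b] + [a,{b,c}]; (iii) ({{a,b},c} − {a,{b,c}}) − ({{a,c},b} − {a,{c,b}}) = {a,[b,c]}. -/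
theorem tridendriform_postlie (R : Type*) [CommRing R] (T : Type*) [AddCommGroup T] [Module R T]
    (pc w sc : T →ₗ[R] T →ₗ[R] T)
    (h1 : ∀ a b c : T, w (w a b) c = w a (w b c))
    (h2 : ∀ a b c : T, pc (pc a b) c = pc a (pc b c) + pc a (w b c) + pc a (sc b c))
    (h3 : ∀ a b c : T, sc a (sc b c) = sc (sc a b) c + sc (w a b) c + sc (pc a b) c)
    (h4 : ∀ a b c : T, pc (sc a b) c = sc a (pc b c))
    (h5 : ∀ a b c : T, w (sc a b) c = sc a (w b c))
    (h6 : ∀ a b c : T, pc (w a b) c = w a (pc b c))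
    (h7 : ∀ a b c : T, w (pc a b) c = w a (sc b c))
    (br : T → T → T) (hbr : ∀ a b : T, br a b = w a b - w b a)
    (cu : T → T → T) (hcu : ∀ a b : T, cu a b = pc a b - sc b a) :
    (∀ a : T, br a a = 0) ∧
    (∀ a b c : T, br (br a b) c + br (br b c) a + br (br c a) b = 0) ∧
    (∀ a b c : T, cu (br a b) c = br (cu a c) b + br a (cu b c)) ∧
    (∀ a b c : T,
      (cu (cu a b) c - cu a (cu b c)) - (cu (cu a c) b - cu a (cu c b)) =
      cu a (br b c)) := by
  refine ⟨fun a => ?_, fun a b c => ?_, fun a b c => ?_, fun a b c => ?_⟩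
  · rw [hbr, sub_self]
  · simp only [hbr, map_sub, LinearMap.sub_apply, h1]
    abel
  · simp only [hbr, hcu, map_sub, LinearMap.sub_apply, h5, h6, h7]
    abel
  · simp only [hbr, hcu, map_sub, LinearMap.sub_apply, h2, h3, h4]
    abel
end

section
/- In every triassociative algebra T over a commutative ring R, the Jordan product a ∘ b := a ⊥ b + b ⊥ a and the Jordan diproduct a • b := a ⊣ b + b ⊢ a satisfy the black right bar identity: a • (b ∘ c) = a • (b • c) for all a, b, c ∈ T. -/
theorem triassociative_black_right_bar (R : Type*) [CommRing R] (T : Type*) [AddCommGroup T] [Module R T]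
    (l p r : T →ₗ[R] T →ₗ[R] T)
    (hla : ∀ a b c : T, l (l a b) c = l a (l b c))
    (hpa : ∀ a b c : T, p (p a b) c = p a (p b c))
    (hra : ∀ a b c : T, r (r a b) c = r a (r b c))
    (hbar1 : ∀ a b c : T, l a (l b c) = l a (p b c))
    (hbar2 : ∀ a b c : T, l a (l b c) = l a (r b c))
    (hbar3 : ∀ a b c : T, r (r a b) c = r (p a b) c)
    (hbar4 : ∀ a b c : T, r (r a b) c = r (l a b) c)
    (hin1 : ∀ a b c : T, l (r a b) c = r a (l b c))
    (hin2 : ∀ a b c : T, p (r a b) c = r a (p b c))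
    (hin3 : ∀ a b c : T, l (p a b) c = p a (l b c))
    (hLR : ∀ a b c : T, p (l a b) c = p a (r b c))
    (o : T → T → T) (ho : ∀ a b : T, o a b = p a b + p b a)
    (bl : T → T → T) (hbl : ∀ a b : T, bl a b = l a b + r b a) :
    ∀ a b c : T, bl a (o b c) = bl a (bl b c) := by
  intro a b c
  simp only [ho, hbl, map_add, LinearMap.add_apply]
  rw [← hbar1 a b c, ← hbar1 a c b, hbar2 a c b, ← hbar3 b c a, hbar4 b c a, ← hbar3 c b a]
end

section
/- In every triassociative algebra T over a commutative ring R, the operations a ∘ b := a ⊥ b + b ⊥ a and a • b := a ⊣ b + b ⊢ a satisfy the identity (a ∘ a) ∘ (a • b) = ((a ∘ a) • b) ∘ a for all a, b ∈ T. -/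
theorem triassociative_jordan_trialgebra_id1 (R : Type*) [CommRing R] (T : Type*) [AddCommGroup T] [Module R T]
    (l p r : T →ₗ[R] T →ₗ[R] T)
    (hla : ∀ a b c : T, l (l a b) c = l a (l b c))
    (hpa : ∀ a b c : T, p (p a b) c = p a (p b c))
    (hra : ∀ a b c : T, r (r a b) c = r a (r b c))
    (hbar1 : ∀ a b c : T, l a (l b c) = l a (p b c))
    (hbar2 : ∀ a b c : T, l a (l b c) = l a (r b c))
    (hbar3 : ∀ a b c : T, r (r a b) c = r (p a b) c)
    (hbar4 : ∀ a b c : T, r (r a b) c = r (l a b) c)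
    (hin1 : ∀ a b c : T, l (r a b) c = r a (l b c))
    (hin2 : ∀ a b c : T, p (r a b) c = r a (p b c))
    (hin3 : ∀ a b c : T, l (p a b) c = p a (l b c))
    (hLR : ∀ a b c : T, p (l a b) c = p a (r b c))
    (o : T → T → T) (ho : ∀ a b : T, o a b = p a b + p b a)
    (bl : T → T → T) (hbl : ∀ a b : T, bl a b = l a b + r b a) :
    ∀ a b : T, o (o a a) (bl a b) = o (bl (o a a) b) a := by
  intro a b
  simp only [ho, hbl, map_add, LinearMap.add_apply, hpa, hin2, hin3, hLR]
  abel
end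

section
/- In every triassociative algebra T over a commutative ring R, the operations a ∘ b := a ⊥ b + b ⊥ a and a • b := a ⊣ b + b ⊢ a satisfy the identity ((a • d) ∘ c) ∘ b + ((b • d) ∘ c) ∘ a + ((a ∘ b) ∘ c) • d = ((a ∘ b) • d) ∘ c + ((a ∘ c) • d) ∘ b + ((b ∘ c) • d) ∘ a for all a, b, c, d ∈ T. -/
theorem triassociative_jordan_trialgebra_id2 (R : Type*) [CommRing R] (T : Type*) [AddCommGroup T] [Module R T]
    (l p r : T →ₗ[R] T →ₗ[R] T)
    (hla : ∀ a b c : T, l (l a b) c = l a (l b c))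
    (hpa : ∀ a b c : T, p (p a b) c = p a (p b c))
    (hra : ∀ a b c : T, r (r a b) c = r a (r b c))
    (hbar1 : ∀ a b c : T, l a (l b c) = l a (p b c))
    (hbar2 : ∀ a b c : T, l a (l b c) = l a (r b c))
    (hbar3 : ∀ a b c : T, r (r a b) c = r (p a b) c)
    (hbar4 : ∀ a b c : T, r (r a b) c = r (l a b) c)
    (hin1 : ∀ a b c : T, l (r a b) c = r a (l b c))
    (hin2 : ∀ a b c : T, p (r a b) c = r a (p b c))
    (hin3 : ∀ a b c : T, l (p a b) c = p a (l b c))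
    (hLR : ∀ a b c : T, p (l a b) c = p a (r b c))
    (o : T → T → T) (ho : ∀ a b : T, o a b = p a b + p b a)
    (bl : T → T → T) (hbl : ∀ a b : T, bl a b = l a b + r b a) :
    ∀ a b c d : T,
      o (o (bl a d) c) b + o (o (bl b d) c) a + bl (o (o a b) c) d =
      o (bl (o a b) d) c + o (bl (o a c) d) b + o (bl (o b c) d) a := by
  intro a b c d
  simp only [ho, hbl, map_add, LinearMap.add_apply, hpa, hin2, hin3, hLR]
  abel
end

section
/- In every triassociative algebra T over a commutative ring R, the operations a ∘ b := a ⊥ b + b ⊥ a and a • b := a ⊣ b + b ⊢ a satisfy the identity ((a • d) • c) ∘ b + ((b • d) • c) ∘ a + ((a ∘ b) • c) • d = (b • (c • d)) ∘ a + ((a • c) ∘ b) • d + ((a • d) ∘ b) • c for all a, b, c, d ∈ T. -/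
theorem triassociative_jordan_trialgebra_id3 (R : Type*) [CommRing R] (T : Type*) [AddCommGroup T] [Module R T]
    (l p r : T →ₗ[R] T →ₗ[R] T)
    (hla : ∀ a b c : T, l (l a b) c = l a (l b c))
    (hpa : ∀ a b c : T, p (p a b) c = p a (p b c))
    (hra : ∀ a b c : T, r (r a b) c = r a (r b c))
    (hbar1 : ∀ a b c : T, l a (l b c) = l a (p b c))
    (hbar2 : ∀ a b c : T, l a (l b c) = l a (r b c))
    (hbar3 : ∀ a b c : T, r (r a b) c = r (p a b) c)
    (hbar4 : ∀ a b c : T, r (r a b) c = r (l a b) c)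
    (hin1 : ∀ a b c : T, l (r a b) c = r a (l b c))
    (hin2 : ∀ a b c : T, p (r a b) c = r a (p b c))
    (hin3 : ∀ a b c : T, l (p a b) c = p a (l b c))
    (hLR : ∀ a b c : T, p (l a b) c = p a (r b c))
    (o : T → T → T) (ho : ∀ a b : T, o a b = p a b + p b a)
    (bl : T → T → T) (hbl : ∀ a b : T, bl a b = l a b + r b a) :
    ∀ a b c d : T,
      o (bl (bl a d) c) b + o (bl (bl b d) c) a + bl (bl (o a b) c) d =
      o (bl b (bl c d)) a + bl (o (bl a c) b) d + bl (o (bl a d) b) c := by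
  intro a b c d
  have hlr : ∀ a b c : T, l a (r b c) = l a (l b c) := fun a b c => (hbar2 a b c).symm
  have hrl : ∀ a b c : T, r (l a b) c = r a (r b c) := fun a b c => by rw [← hbar4, hra]
  simp only [ho, hbl, map_add, LinearMap.add_apply, hla, hra, hlr, hrl,
    hin1, hin2, hin3, hLR]
  abel
end

section
/- In every triassociative algebra T over a commutative ring R, the operations a ∘ b := a ⊥ b + b ⊥ a and a • b := a ⊣ b + b ⊢ a satisfy the identity (a • c) ∘ (b • d) + (a • d) ∘ (b • c) + (a ∘ b) • (c • d) = (b • (c • d)) ∘ a + ((a • c) ∘ b) • d + ((a • d) ∘ b) • c for all a, b, c, d ∈ T. -/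
theorem triassociative_jordan_trialgebra_id4 (R : Type*) [CommRing R] (T : Type*) [AddCommGroup T] [Module R T]
    (l p r : T →ₗ[R] T →ₗ[R] T)
    (hla : ∀ a b c : T, l (l a b) c = l a (l b c))
    (hpa : ∀ a b c : T, p (p a b) c = p a (p b c))
    (hra : ∀ a b c : T, r (r a b) c = r a (r b c))
    (hbar1 : ∀ a b c : T, l a (l b c) = l a (p b c))
    (hbar2 : ∀ a b c : T, l a (l b c) = l a (r b c))
    (hbar3 : ∀ a b c : T, r (r a b) c = r (p a b) c)
    (hbar4 : ∀ a b c : T, r (r a b) c = r (l a b) c)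
    (hin1 : ∀ a b c : T, l (r a b) c = r a (l b c))
    (hin2 : ∀ a b c : T, p (r a b) c = r a (p b c))
    (hin3 : ∀ a b c : T, l (p a b) c = p a (l b c))
    (hLR : ∀ a b c : T, p (l a b) c = p a (r b c))
    (o : T → T → T) (ho : ∀ a b : T, o a b = p a b + p b a)
    (bl : T → T → T) (hbl : ∀ a b : T, bl a b = l a b + r b a) :
    ∀ a b c d : T,
      o (bl a c) (bl b d) + o (bl a d) (bl b c) + bl (o a b) (bl c d) =
      o (bl b (bl c d)) a + bl (o (bl a c) b) d + bl (o (bl a d) b) c := by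
  intro a b c d
  simp only [ho, hbl, map_add, LinearMap.add_apply, hla, hra, ← hbar2, ← hbar4, hin1, hin2, hin3,
    hLR]
  abel
end

section
/- In every tridendriform algebra T over a commutative ring R, the Jordan product a ∘ b := a ∧ b + b ∧ a and the pre-Jordan product a • b := a ≺ b + b ≻ a satisfy the identity ((c • a) ∘ b) ∘ d + ((d • a) ∘ b) ∘ c − ((b ∘ c) • a) ∘ d − ((b ∘ d) • a) ∘ c − ((c ∘ d) • a) ∘ b + ((c ∘ d) ∘ b) • a = 0 for all a, b, c, d ∈ T. -/
theorem tridendriform_postjordan_id1 (R : Type*) [CommRing R] (T : Type*) [AddCommGroup T] [Module R T]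
    (pc w sc : T →ₗ[R] T →ₗ[R] T)
    (h1 : ∀ a b c : T, w (w a b) c = w a (w b c))
    (h2 : ∀ a b c : T, pc (pc a b) c = pc a (pc b c) + pc a (w b c) + pc a (sc b c))
    (h3 : ∀ a b c : T, sc a (sc b c) = sc (sc a b) c + sc (w a b) c + sc (pc a b) c)
    (h4 : ∀ a b c : T, pc (sc a b) c = sc a (pc b c))
    (h5 : ∀ a b c : T, w (sc a b) c = sc a (w b c))
    (h6 : ∀ a b c : T, pc (w a b) c = w a (pc b c))
    (h7 : ∀ a b c : T, w (pc a b) c = w a (sc b c))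
    (o : T → T → T) (ho : ∀ a b : T, o a b = w a b + w b a)
    (bl : T → T → T) (hbl : ∀ a b : T, bl a b = pc a b + sc b a) :
    ∀ a b c d : T,
      o (o (bl c a) b) d + o (o (bl d a) b) c - o (bl (o b c) a) d -
      o (bl (o b d) a) c - o (bl (o c d) a) b + bl (o (o c d) b) a = 0 := by
  intro a b c d
  simp only [ho, hbl, map_add, LinearMap.add_apply, h1, h5, h6, h7]
  abel
end

section
/- In every tridendriform algebra T over a commutative ring R, the Jordan product a ∘ b := a ∧ b + b ∧ a and the pre-Jordan product a • b := a ≺ b + b ≻ a satisfy the identity ((b ∘ c) • a) ∘ d + ((b ∘ d) • a) ∘ c + ((c ∘ d) • a) ∘ b = (b ∘ c) ∘ (d • a) + (b ∘ d) ∘ (c • a) + (c ∘ d) ∘ (b • a) for all a, b, c, d ∈ T. -/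
theorem tridendriform_postjordan_id2 (R : Type*) [CommRing R] (T : Type*) [AddCommGroup T] [Module R T]
    (pc w sc : T →ₗ[R] T →ₗ[R] T)
    (h1 : ∀ a b c : T, w (w a b) c = w a (w b c))
    (h2 : ∀ a b c : T, pc (pc a b) c = pc a (pc b c) + pc a (w b c) + pc a (sc b c))
    (h3 : ∀ a b c : T, sc a (sc b c) = sc (sc a b) c + sc (w a b) c + sc (pc a b) c)
    (h4 : ∀ a b c : T, pc (sc a b) c = sc a (pc b c))
    (h5 : ∀ a b c : T, w (sc a b) c = sc a (w b c))
    (h6 : ∀ a b c : T, pc (w a b) c = w a (pc b c))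
    (h7 : ∀ a b c : T, w (pc a b) c = w a (sc b c))
    (o : T → T → T) (ho : ∀ a b : T, o a b = w a b + w b a)
    (bl : T → T → T) (hbl : ∀ a b : T, bl a b = pc a b + sc b a) :
    ∀ a b c d : T,
      o (bl (o b c) a) d + o (bl (o b d) a) c + o (bl (o c d) a) b =
      o (o b c) (bl d a) + o (o b d) (bl c a) + o (o c d) (bl b a) := by
  intro a b c d
  simp only [ho, hbl, map_add, LinearMap.add_apply, h1, h5, h6, h7]
  abel
end
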